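/- Let F be a field of characteristic 0 and let B be an n×n symmetric matrix over F with qpr(B) = q_1 q_2 ⋯ q_{n−1} A, where q_k ∈ {A, S} for k = 1, …, n−1. Then there exists an (n+1)×(n+1) symmetric matrix B' over F such that qpr(B') = q_1 q_2 ⋯ q_{n−1} S N. -/

import Mathlib

open Matrix

/-- The minor of a square matrix `B` lying in the rows indexed by `α` and the columns
indexed by `β` (each listed in increasing order); junk value `0` if `α.card ≠ β.card`. -/
def qMinor {R : Type*} [CommRing R] {m : Type*} [Fintype m] [LinearOrder m]
    (B : Matrix m m R) (α β : Finset m) : R :=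
  if h : β.card = α.card then
    (Matrix.of fun i j : Fin α.card =>
      B (α.orderEmbOfFin rfl i) (β.orderEmbOfFin h j)).det
  else 0

/-- `α` and `β` index a quasi-principal submatrix of order `k`, i.e.
`|α| = |β| = k` and `k - 1 ≤ |α ∩ β| (≤ k)`. -/
def IsQPPair {m : Type*} [DecidableEq m] (k : ℕ) (α β : Finset m) : Prop :=
  α.card = k ∧ β.card = k ∧ k - 1 ≤ (α ∩ β).card

/-- All quasi-principal minors of `B` of order `k` are nonzero. -/
def QPAllNonzero {R : Type*} [CommRing R] {m : Type*} [Fintype m] [LinearOrder m]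
    (B : Matrix m m R) (k : ℕ) : Prop :=
  ∀ α β : Finset m, IsQPPair k α β → qMinor B α β ≠ 0

/-- All quasi-principal minors of `B` of order `k` are zero. -/
def QPAllZero {R : Type*} [CommRing R] {m : Type*} [Fintype m] [LinearOrder m]
    (B : Matrix m m R) (k : ℕ) : Prop :=
  ∀ α β : Finset m, IsQPPair k α β → qMinor B α β = 0

/-- The three possible letters of a qpr-sequence. -/
inductive QPR : Type
  | A
  | S
  | N
deriving DecidableEq

open Classical in
/-- The letter of the qpr-sequence of `B` corresponding to order `k`:
`A` if all quasi-principal minors of order `k` are nonzero, `N` if all are zero,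
and `S` otherwise. -/
noncomputable def qprEntry {R : Type*} [CommRing R] {m : Type*} [Fintype m] [LinearOrder m]
    (B : Matrix m m R) (k : ℕ) : QPR :=
  if QPAllNonzero B k then QPR.A
  else if QPAllZero B k then QPR.N
  else QPR.S

/-- A sequence of letters `q 0, …, q (n-1)` (standing for `q_1 ⋯ q_n`) is attainable
over `F` if it is the qpr-sequence of an `n × n` symmetric matrix over `F`. -/
def Attainable (F : Type*) [Field F] {n : ℕ} (q : Fin n → QPR) : Prop :=
  ∃ B : Matrix (Fin n) (Fin n) F, B.IsSymm ∧ ∀ k : Fin n, qprEntry B ((k : ℕ) + 1) = q k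

/-- The Schur complement `B/B[γ] = B[γᶜ] - B[γᶜ, γ] B[γ]⁻¹ B[γ, γᶜ]`,
with rows and columns indexed by `γᶜ` (indexing inherited from `B`). -/
noncomputable def schurCompl {R : Type*} [CommRing R] {n : ℕ}
    (B : Matrix (Fin n) (Fin n) R) (γ : Finset (Fin n)) :
    Matrix ↥(γᶜ) ↥(γᶜ) R :=
  B.submatrix (fun i : ↥(γᶜ) => (i : Fin n)) (fun j : ↥(γᶜ) => (j : Fin n)) -
    B.submatrix (fun i : ↥(γᶜ) => (i : Fin n)) (fun j : ↥γ => (j : Fin n)) *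
      (B.submatrix (fun i : ↥γ => (i : Fin n)) fun j : ↥γ => (j : Fin n))⁻¹ *
      B.submatrix (fun i : ↥γ => (i : Fin n)) fun j : ↥(γᶜ) => (j : Fin n)

/-- The `(m+1) × (m+1)` matrix with block form `[[A, x], [yᵀ, b]]`. -/
def borderMat {R : Type*} [CommRing R] {m : ℕ} (A : Matrix (Fin m) (Fin m) R)
    (x y : Fin m → R) (b : R) : Matrix (Fin (m + 1)) (Fin (m + 1)) R :=
  Matrix.of fun i j =>
    if hi : (i : ℕ) < m then
      if hj : (j : ℕ) < m then A ⟨i, hi⟩ ⟨j, hj⟩ else x ⟨i, hi⟩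
    else
      if hj : (j : ℕ) < m then y ⟨j, hj⟩ else b

section Helpers

theorem qMinor_ne_zero_iff {F : Type*} [Field F] {m : Type*} [Fintype m] [LinearOrder m]
    (B : Matrix m m F) (α β : Finset m) (h : β.card = α.card) :
    qMinor B α β ≠ 0 ↔ ∀ v : m → F, (∀ j, j ∉ β → v j = 0) →
      (∀ i ∈ α, (B *ᵥ v) i = 0) → v = 0 := by
  classical
  have key : ∀ v : m → F, (∀ j, j ∉ β → v j = 0) → ∀ i,
      ((Matrix.of fun i j : Fin α.card =>
        B (α.orderEmbOfFin rfl i) (β.orderEmbOfFin h j)) *ᵥ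
          (fun j => v (β.orderEmbOfFin h j))) i = (B *ᵥ v) (α.orderEmbOfFin rfl i) := by
    intro v hv i
    simp only [Matrix.mulVec, dotProduct, Matrix.of_apply]
    have h1 := Finset.sum_map Finset.univ (β.orderEmbOfFin h).toEmbedding
      (fun j => B (α.orderEmbOfFin rfl i) j * v j)
    have h2 : Finset.map (β.orderEmbOfFin h).toEmbedding Finset.univ = β := by
      ext y
      have := Set.ext_iff.1 (Finset.range_orderEmbOfFin β h) y
      simpa using this
    rw [h2] at h1
    rw [← Finset.sum_subset (Finset.subset_univ β)
      (fun j _ hj => by rw [hv j hj, mul_zero]), h1]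
    rfl
  unfold qMinor
  rw [dif_pos h, Ne, ← Matrix.exists_mulVec_eq_zero_iff]
  constructor
  · intro H v hv hα
    by_contra hne
    apply H
    refine ⟨fun j => v (β.orderEmbOfFin h j), ?_, ?_⟩
    · intro h0
      apply hne
      funext j
      by_cases hj : j ∈ β
      · have := (Set.ext_iff.1 (Finset.range_orderEmbOfFin β h) j).2 hj
        obtain ⟨t, rfl⟩ := this
        exact congrFun h0 t
      · exact hv j hj
    · funext i
      rw [key v hv i]
      exact hα _ (Finset.orderEmbOfFin_mem α rfl i)
  · rintro H ⟨u, hu, h0⟩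
    apply hu
    set v : m → F := Function.extend (β.orderEmbOfFin h) u 0 with hvdef
    have hvu : ∀ j, v (β.orderEmbOfFin h j) = u j := fun j =>
      (β.orderEmbOfFin h).injective.extend_apply _ _ _
    have hv : ∀ j, j ∉ β → v j = 0 := by
      intro j hj
      rw [hvdef, Function.extend_apply']
      · rfl
      · rintro ⟨t, rfl⟩
        exact hj (Finset.orderEmbOfFin_mem β h t)
    have hz : v = 0 := by
      apply H v hv
      intro i hi
      obtain ⟨t, rfl⟩ := (Set.ext_iff.1 (Finset.range_orderEmbOfFin α rfl) i).2 hi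
      rw [← key v hv t]
      have : (fun j => v (β.orderEmbOfFin h j)) = u := funext hvu
      rw [this, h0]
      rfl
    funext j
    rw [← hvu j, hz]
    rfl

/-- The `n × (n+1)` matrix `[I | x]`. -/
def extC {R : Type*} [CommRing R] {n : ℕ} (x : Fin n → R) : Matrix (Fin n) (Fin (n + 1)) R :=
  Matrix.of fun u j => Fin.snoc (α := fun _ => R) (fun l : Fin n => if l = u then 1 else 0) (x u) j

/-- The bordered matrix `Cᵀ B C`. -/
def extB {R : Type*} [CommRing R] {n : ℕ} (B : Matrix (Fin n) (Fin n) R) (x : Fin n → R) :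
    Matrix (Fin (n + 1)) (Fin (n + 1)) R :=
  (extC x)ᵀ * B * extC x

theorem extC_mulVec {R : Type*} [CommRing R] {n : ℕ} (x : Fin n → R) (v : Fin (n + 1) → R)
    (u : Fin n) : (extC x *ᵥ v) u = v u.castSucc + v (Fin.last n) * x u := by
  simp [extC, Matrix.mulVec, dotProduct, Fin.sum_univ_castSucc, mul_comm]

theorem extC_tr_castSucc {R : Type*} [CommRing R] {n : ℕ} (x w : Fin n → R) (j : Fin n) :
    ((extC x)ᵀ *ᵥ w) j.castSucc = w j := by
  simp [extC, Matrix.mulVec, dotProduct]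

theorem extC_tr_last {R : Type*} [CommRing R] {n : ℕ} (x w : Fin n → R) :
    ((extC x)ᵀ *ᵥ w) (Fin.last n) = ∑ u, x u * w u := by
  simp [extC, Matrix.mulVec, dotProduct]

theorem extB_mulVec {R : Type*} [CommRing R] {n : ℕ} (B : Matrix (Fin n) (Fin n) R)
    (x : Fin n → R) (v : Fin (n + 1) → R) :
    extB B x *ᵥ v = (extC x)ᵀ *ᵥ (B *ᵥ (extC x *ᵥ v)) := by
  simp [extB, Matrix.mulVec_mulVec, Matrix.mul_assoc]

theorem extB_map {R S : Type*} [CommRing R] [CommRing S] (f : R →+* S) {n : ℕ}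
    (B : Matrix (Fin n) (Fin n) R) (x : Fin n → R) :
    (extB B x).map f = extB (B.map f) (fun i => f (x i)) := by
  have hC : (extC x).map f = extC (fun i => f (x i)) := by
    ext u j
    refine Fin.lastCases ?_ (fun l => ?_) j
    · simp [extC]
    · simp [extC]
  simp only [extB, Matrix.map_mul, ← hC, Matrix.transpose_map]

theorem qMinor_map {R S : Type*} [CommRing R] [CommRing S] (f : R →+* S) {m : Type*} [Fintype m]
    [LinearOrder m] (B : Matrix m m R) (α β : Finset m) :
    f (qMinor B α β) = qMinor (B.map f) α β := by
  unfold qMinor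
  split_ifs with h
  · rw [RingHom.map_det]; rfl
  · simp

theorem qMinor_castSucc {F : Type*} [Field F] {n : ℕ} (B : Matrix (Fin n) (Fin n) F)
    (x : Fin n → F) (α β : Finset (Fin n)) (h : β.card = α.card) :
    qMinor (extB B x) (α.map Fin.castSuccEmb) (β.map Fin.castSuccEmb) ≠ 0 ↔
      qMinor B α β ≠ 0 := by
  rw [qMinor_ne_zero_iff _ _ _ (by simpa using h), qMinor_ne_zero_iff _ _ _ h]
  constructor
  · intro H v hv hα
    have := H (Fin.snoc (α := fun _ => F) v 0) ?_ ?_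
    · funext j
      simpa using congrFun this j.castSucc
    · intro j
      refine Fin.lastCases ?_ (fun l => ?_) j
      · simp
      · simpa using hv l
    · intro i hi
      obtain ⟨l, hl, rfl⟩ := Finset.mem_map.1 hi
      have hC : extC x *ᵥ (Fin.snoc (α := fun _ => F) v 0) = v := by
        funext u; simp [extC_mulVec]
      rw [extB_mulVec, hC]
      exact (extC_tr_castSucc x _ l).trans (hα l hl)
  · intro H v hv hα
    have hlast : v (Fin.last n) = 0 := hv _ (by simp)
    have hC : extC x *ᵥ v = fun u => v u.castSucc := by
      funext u; simp [extC_mulVec, hlast]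
    have := H (fun u => v u.castSucc) (fun j hj => hv _ (by simpa using hj)) ?_
    · funext j
      refine Fin.lastCases hlast (fun l => ?_) j
      exact congrFun this l
    · intro i hi
      have := hα i.castSucc (by simpa using hi)
      rw [extB_mulVec, hC, extC_tr_castSucc] at this
      exact this

theorem single_case {F : Type*} [Field F] {n k : ℕ}
    (B : Matrix (Fin n) (Fin n) F) (hA : QPAllNonzero B k) (α β : Finset (Fin (n + 1)))
    (hqp : IsQPPair k α β) (l : Fin n) (h1 : Fin.last n ∈ α → l.castSucc ∉ α)
    (h2 : Fin.last n ∈ β → l.castSucc ∉ β) :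
    qMinor (extB B (Pi.single l 1)) α β ≠ 0 := by
  classical
  obtain ⟨hα, hβ, hαβ⟩ := hqp
  set φ : Fin (n + 1) → Fin n := Fin.snoc (α := fun _ => Fin n) id l with hφ
  have hinj : ∀ s : Finset (Fin (n + 1)), (Fin.last n ∈ s → l.castSucc ∉ s) →
      Set.InjOn φ s := by
    intro s hs a ha b hb hab
    revert ha hb hab
    refine Fin.lastCases ?_ (fun a => ?_) a <;> refine Fin.lastCases ?_ (fun b => ?_) b <;>
      simp only [hφ, Fin.snoc_last, Fin.snoc_castSucc, id]
    · intros; trivial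
    · rintro ha hb rfl; exact absurd hb (hs ha)
    · rintro ha hb rfl; exact absurd ha (hs hb)
    · rintro _ _ rfl; rfl
  have hq : IsQPPair k (α.image φ) (β.image φ) := by
    refine ⟨by rw [Finset.card_image_of_injOn (hinj α h1), hα],
      by rw [Finset.card_image_of_injOn (hinj β h2), hβ], hαβ.trans ?_⟩
    rw [← Finset.card_image_of_injOn ((hinj α h1).mono
      (by exact_mod_cast Finset.inter_subset_left : ((α ∩ β : Finset _) : Set (Fin (n+1))) ⊆ α))]
    apply Finset.card_le_card
    exact Finset.image_inter_subset _ _ _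
  have hne := hA _ _ hq
  rw [qMinor_ne_zero_iff _ _ _ (hq.2.1.trans hq.1.symm)] at hne
  rw [qMinor_ne_zero_iff _ _ _ (hβ.trans hα.symm)]
  intro v hv hz
  have hw := hne (extC (Pi.single l 1) *ᵥ v) ?_ ?_
  · have hval : ∀ u, v u.castSucc + v (Fin.last n) * (Pi.single l 1 : Fin n → F) u = 0 := by
      intro u; rw [← extC_mulVec, hw]; rfl
    have hlast : v (Fin.last n) = 0 := by
      by_cases hl : Fin.last n ∈ β
      · have := hval l
        rw [hv _ (h2 hl)] at this
        simpa using this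
      · exact hv _ hl
    funext j
    refine Fin.lastCases hlast (fun u => ?_) j
    simpa [hlast] using hval u
  · intro j hj
    rw [extC_mulVec]
    have e1 : v j.castSucc = 0 := by
      apply hv
      intro hmem
      exact hj (Finset.mem_image.2 ⟨_, hmem, by simp [hφ]⟩)
    rw [e1, zero_add]
    by_cases hjl : j = l
    · have : v (Fin.last n) = 0 := by
        apply hv
        intro hmem
        exact hj (Finset.mem_image.2 ⟨_, hmem, by simp [hφ, hjl]⟩)
      rw [this, zero_mul]
    · simp [Pi.single_apply, hjl]
  · intro i hi
    obtain ⟨t, ht, rfl⟩ := Finset.mem_image.1 hi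
    have := hz t ht
    rw [extB_mulVec] at this
    revert this
    refine Fin.lastCases ?_ (fun s => ?_) t
    · rw [extC_tr_last]
      simp [hφ, Pi.single_apply]
    · rw [extC_tr_castSucc]
      simp [hφ]

theorem double_case {F : Type*} [Field F] {n k : ℕ}
    (B : Matrix (Fin n) (Fin n) F) (hA : QPAllNonzero B k) (α β : Finset (Fin (n + 1)))
    (hqp : IsQPPair k α β) (hlα : Fin.last n ∈ α) (hlβ : Fin.last n ∈ β)
    (δ : Finset (Fin n)) (hδ : ∀ l, l ∈ δ ↔ l.castSucc ∈ α ∨ l.castSucc ∈ β)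
    (hcard : δ.card = k) :
    ∃ a ∈ δ, ∃ b ∈ δ, qMinor (extB B (Pi.single a 1 + Pi.single b 1)) α β ≠ 0 := by
  classical
  obtain ⟨hα, hβ, hαβ⟩ := hqp
  -- α ≠ β, and the differences are singletons
  have hsub : δ.map Fin.castSuccEmb ⊆ (α ∪ β).erase (Fin.last n) := by
    intro y hy
    obtain ⟨l, hl, rfl⟩ := Finset.mem_map.1 hy
    simpa [Fin.castSucc_ne_last] using (hδ l).1 hl
  have hc1 := Finset.card_le_card hsub
  rw [Finset.card_map, hcard, Finset.card_erase_of_mem (by simp [hlα])] at hc1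
  have hk : 1 ≤ k := by rw [← hα]; exact Finset.card_pos.2 ⟨_, hlα⟩
  have hu := Finset.card_union_add_card_inter α β
  have hda := Finset.card_sdiff_add_card_inter α β
  have hdb := Finset.card_sdiff_add_card_inter β α
  rw [Finset.inter_comm β α] at hdb
  have hA1 : (α \ β).card = 1 := by omega
  have hB1 : (β \ α).card = 1 := by omega
  obtain ⟨a', ha'⟩ := Finset.card_eq_one.1 hA1
  obtain ⟨b', hb'⟩ := Finset.card_eq_one.1 hB1
  have ha1 : a' ∈ α ∧ a' ∉ β := by rw [← Finset.mem_sdiff, ha']; simp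
  have hb1 : b' ∈ β ∧ b' ∉ α := by rw [← Finset.mem_sdiff, hb']; simp
  obtain ⟨a, rfl⟩ : ∃ a : Fin n, a.castSucc = a' :=
    Fin.exists_castSucc_eq.2 (fun h => ha1.2 (h ▸ hlβ))
  obtain ⟨b, rfl⟩ : ∃ b : Fin n, b.castSucc = b' :=
    Fin.exists_castSucc_eq.2 (fun h => hb1.2 (h ▸ hlα))
  have haδ : a ∈ δ := (hδ a).2 (Or.inl ha1.1)
  have hbδ : b ∈ δ := (hδ b).2 (Or.inr hb1.1)
  have hab : a ≠ b := by rintro rfl; exact ha1.2 hb1.1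
  refine ⟨a, haδ, b, hbδ, ?_⟩
  have hne := hA δ δ ⟨hcard, hcard, by rw [Finset.inter_self]; omega⟩
  rw [qMinor_ne_zero_iff _ _ _ rfl] at hne
  rw [qMinor_ne_zero_iff _ _ _ (hβ.trans hα.symm)]
  intro v hv hz
  set x : Fin n → F := Pi.single a 1 + Pi.single b 1 with hx
  have hw := hne (extC x *ᵥ v) ?_ ?_
  · have hval : ∀ u, v u.castSucc + v (Fin.last n) * x u = 0 := by
      intro u; rw [← extC_mulVec, hw]; rfl
    have hlast : v (Fin.last n) = 0 := by
      have := hval a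
      rw [hv _ ha1.2] at this
      simpa [hx, Pi.single_apply, hab] using this
    funext j
    refine Fin.lastCases hlast (fun u => ?_) j
    simpa [hlast] using hval u
  · intro j hj
    rw [extC_mulVec]
    have e1 : v j.castSucc = 0 := hv _ (fun hmem => hj ((hδ j).2 (Or.inr hmem)))
    have hja : j ≠ a := by rintro rfl; exact hj haδ
    have hjb : j ≠ b := by rintro rfl; exact hj hbδ
    simp [e1, hx, Pi.single_apply, hja, hjb]
  · have hαz : ∀ i : Fin n, i.castSucc ∈ α → (B *ᵥ (extC x *ᵥ v)) i = 0 := by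
      intro i hi
      have := hz _ hi
      rwa [extB_mulVec, extC_tr_castSucc] at this
    intro i hi
    by_cases hiα : i.castSucc ∈ α
    · exact hαz i hiα
    · have hib : i = b := by
        have : i.castSucc ∈ β \ α :=
          Finset.mem_sdiff.2 ⟨((hδ i).1 hi).resolve_left hiα, hiα⟩
        rw [hb'] at this
        simpa using this
      subst hib
      have h0 := hz _ hlα
      rw [extB_mulVec, extC_tr_last] at h0
      have haz := hαz a ha1.1
      generalize B *ᵥ (extC x *ᵥ v) = w at h0 haz ⊢
      simpa [hx, Pi.single_apply, add_mul, Finset.sum_add_distrib, haz] using h0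

theorem pointwise_case {F : Type*} [Field F] {n k : ℕ} (z : Fin n) (hk : 1 ≤ k) (hkn : k + 1 ≤ n)
    (B : Matrix (Fin n) (Fin n) F) (hA : QPAllNonzero B k) (α β : Finset (Fin (n + 1)))
    (hqp : IsQPPair k α β) :
    ∃ x : Fin n → F, x z = 0 ∧ qMinor (extB B x) α β ≠ 0 := by
  classical
  by_cases hl : ∃ l : Fin n, l ≠ z ∧ (Fin.last n ∈ α → l.castSucc ∉ α) ∧
      (Fin.last n ∈ β → l.castSucc ∉ β)
  · obtain ⟨l, hlz, h1, h2⟩ := hl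
    exact ⟨Pi.single l 1, by simp [Pi.single_apply, hlz.symm], single_case B hA α β hqp l h1 h2⟩
  · push Not at hl
    -- a general counting fact
    have hcount : ∀ s : Finset (Fin (n + 1)), Fin.last n ∈ s →
        ∀ δ : Finset (Fin n), (∀ l, l ∈ δ → l.castSucc ∈ s) → δ.card + 1 ≤ s.card := by
      intro s hs δ hδ
      have hsub : δ.map Fin.castSuccEmb ⊆ s.erase (Fin.last n) := by
        intro y hy
        obtain ⟨l, hl, rfl⟩ := Finset.mem_map.1 hy
        simpa [Fin.castSucc_ne_last] using hδ l hl
      have := Finset.card_le_card hsub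
      rw [Finset.card_map, Finset.card_erase_of_mem hs] at this
      have : 1 ≤ s.card := Finset.card_pos.2 ⟨_, hs⟩
      omega
    have hcz : (Finset.univ.erase z).card = n - 1 := by
      rw [Finset.card_erase_of_mem (Finset.mem_univ _)]; simp
    obtain ⟨hα, hβ, hαβ⟩ := id hqp
    by_cases hlα : Fin.last n ∈ α
    · by_cases hlβ : Fin.last n ∈ β
      · set δ : Finset (Fin n) :=
          Finset.univ.filter (fun l => l.castSucc ∈ α ∨ l.castSucc ∈ β) with hδdef
        have hδ : ∀ l, l ∈ δ ↔ l.castSucc ∈ α ∨ l.castSucc ∈ β := by simp [hδdef]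
        have hle := hcount (α ∪ β) (by simp [hlα]) δ (fun l hl => by simpa using (hδ l).1 hl)
        have hu := Finset.card_union_add_card_inter α β
        have hsub : Finset.univ.erase z ⊆ δ := by
          intro l hlm
          rw [hδ]
          by_contra hcon
          push Not at hcon
          exact hcon.2 (hl l (Finset.ne_of_mem_erase hlm) (fun _ => hcon.1)).2
        have hge := Finset.card_le_card hsub
        have hcard : δ.card = k := by omega
        have heq : Finset.univ.erase z = δ := Finset.eq_of_subset_of_card_le hsub (by omega)
        have hzδ : z ∉ δ := by rw [← heq]; simp
        obtain ⟨a, ha, b, hb, h⟩ := double_case B hA α β hqp hlα hlβ δ hδ hcard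
        have hza : z ≠ a := by rintro rfl; exact hzδ ha
        have hzb : z ≠ b := by rintro rfl; exact hzδ hb
        exact ⟨_, by simp [Pi.single_apply, hza, hzb], h⟩
      · exfalso
        have := hcount α hlα (Finset.univ.erase z) (fun l hlm => by
          by_contra hcon
          exact hlβ (hl l (Finset.ne_of_mem_erase hlm) (fun _ => hcon)).1)
        omega
    · exfalso
      by_cases hlβ : Fin.last n ∈ β
      · have := hcount β hlβ (Finset.univ.erase z) (fun l hlm =>
          (hl l (Finset.ne_of_mem_erase hlm) (fun h => absurd h hlα)).2)
        omega
      · have : 0 < (Finset.univ.erase z).card := by omega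
        obtain ⟨l, hlm⟩ := Finset.card_pos.1 this
        exact hlβ (hl l (Finset.ne_of_mem_erase hlm) (fun h => absurd h hlα)).1

theorem generic_case {F : Type*} [Field F] [CharZero F] {n : ℕ} (z : Fin n)
    (B : Matrix (Fin n) (Fin n) F) :
    ∃ x : Fin n → F, x z = 0 ∧ ∀ k, 1 ≤ k → k + 1 ≤ n → QPAllNonzero B k →
      QPAllNonzero (extB B x) k := by
  classical
  set X : Fin n → MvPolynomial (Fin n) F := fun l => if l = z then 0 else MvPolynomial.X l with hX
  set P : Finset (Fin (n + 1)) × Finset (Fin (n + 1)) → MvPolynomial (Fin n) F := fun p =>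
    qMinor (extB (B.map MvPolynomial.C) X) p.1 p.2 with hP
  have hev : ∀ (y : Fin n → F) p, MvPolynomial.eval y (P p) =
      qMinor (extB B (fun l => if l = z then 0 else y l)) p.1 p.2 := by
    intro y p
    rw [hP]
    simp only
    rw [qMinor_map, extB_map]
    congr 2
    · ext i j; simp
    · funext l
      simp only [hX]
      split_ifs <;> simp
  set T : Finset (Finset (Fin (n + 1)) × Finset (Fin (n + 1))) :=
    Finset.univ.filter (fun p => P p ≠ 0) with hT
  have hprod : (∏ p ∈ T, P p) ≠ 0 := by
    rw [Finset.prod_ne_zero_iff]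
    intro p hp
    exact (Finset.mem_filter.1 hp).2
  obtain ⟨y, hy⟩ : ∃ y, MvPolynomial.eval y (∏ p ∈ T, P p) ≠ 0 := by
    by_contra hcon
    push Not at hcon
    exact hprod (MvPolynomial.funext (fun y => by rw [hcon y, map_zero]))
  rw [map_prod, Finset.prod_ne_zero_iff] at hy
  refine ⟨fun l => if l = z then 0 else y l, by simp, ?_⟩
  intro k hk hkn hA α β hqp
  obtain ⟨x, hxz, hx⟩ := pointwise_case z hk hkn B hA α β hqp
  have hPne : P (α, β) ≠ 0 := by
    intro h0
    apply hx
    have := hev x (α, β)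
    rw [h0, map_zero] at this
    have hxx : (fun l => if l = z then 0 else x l) = x := by
      funext l
      split_ifs with h
      · rw [h, hxz]
      · rfl
    rw [hxx] at this
    exact this.symm
  have := hy (α, β) (Finset.mem_filter.2 ⟨Finset.mem_univ _, hPne⟩)
  rwa [hev] at this

theorem qprEntry_eq_A {R : Type*} [CommRing R] {m : Type*} [Fintype m] [LinearOrder m]
    (B : Matrix m m R) (k : ℕ) : qprEntry B k = QPR.A ↔ QPAllNonzero B k := by
  unfold qprEntry; split_ifs <;> simp_all

theorem qprEntry_eq_S {R : Type*} [CommRing R] {m : Type*} [Fintype m] [LinearOrder m]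
    (B : Matrix m m R) (k : ℕ) :
    qprEntry B k = QPR.S ↔ ¬ QPAllNonzero B k ∧ ¬ QPAllZero B k := by
  unfold qprEntry; split_ifs <;> simp_all

theorem qprEntry_eq_N {R : Type*} [CommRing R] {m : Type*} [Fintype m] [LinearOrder m]
    (B : Matrix m m R) (k : ℕ) :
    qprEntry B k = QPR.N ↔ ¬ QPAllNonzero B k ∧ QPAllZero B k := by
  unfold qprEntry; split_ifs <;> simp_all

theorem isQPPair_self {m : Type*} [DecidableEq m] (α : Finset m) : IsQPPair α.card α α :=
  ⟨rfl, rfl, by simp⟩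

theorem isQPPair_map {n k : ℕ} {α β : Finset (Fin n)} (h : IsQPPair k α β) :
    IsQPPair k (α.map Fin.castSuccEmb) (β.map Fin.castSuccEmb) := by
  obtain ⟨h1, h2, h3⟩ := h
  refine ⟨by simpa using h1, by simpa using h2, ?_⟩
  rw [← Finset.map_inter]
  simpa using h3

end Helpers

/-- over a field of characteristic 0, if `B` is an `n × n` symmetric matrix
with `qpr(B) = q_1 ⋯ q_{n-1} A` and `q_k ∈ {A, S}` for `k = 1, …, n-1`, then there is an
`(n+1) × (n+1)` symmetric matrix `B'` with `qpr(B') = q_1 ⋯ q_{n-1} S N`. -/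
theorem stmt_10 {F : Type*} [Field F] [CharZero F] {n : ℕ} (hn : 0 < n)
    (B : Matrix (Fin n) (Fin n) F) (hB : B.IsSymm)
    (hAS : ∀ k : ℕ, 1 ≤ k → k ≤ n - 1 →
      qprEntry B k = QPR.A ∨ qprEntry B k = QPR.S)
    (hlast : qprEntry B n = QPR.A) :
    ∃ B' : Matrix (Fin (n + 1)) (Fin (n + 1)) F, B'.IsSymm ∧
      (∀ k : ℕ, 1 ≤ k → k ≤ n - 1 → qprEntry B' k = qprEntry B k) ∧
      qprEntry B' n = QPR.S ∧ qprEntry B' (n + 1) = QPR.N := by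
  set z : Fin n := ⟨0, hn⟩
  obtain ⟨x, hxz, hx⟩ := generic_case z B
  -- order-`n+1` minor vanishes
  have hcz : (Finset.univ.erase z.castSucc).card = n := by
    rw [Finset.card_erase_of_mem (Finset.mem_univ _)]; simp
  have hker : extC x *ᵥ (Fin.snoc (α := fun _ => F) (fun u => - x u) 1) = 0 := by
    funext u; simp [extC_mulVec]
  have hv0 : (Fin.snoc (α := fun _ => F) (fun u => - x u) 1 : Fin (n + 1) → F) ≠ 0 := by
    intro h
    have := congrFun h (Fin.last n)
    simp at this
  have hzero : ∀ α β : Finset (Fin (n + 1)), β.card = α.card → Finset.univ.erase z.castSucc ⊆ β →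
      qMinor (extB B x) α β = 0 := by
    intro α β hc hβ
    by_contra hne
    have := (qMinor_ne_zero_iff _ _ _ hc).1 hne
      (Fin.snoc (α := fun _ => F) (fun u => - x u) 1) ?_ ?_
    · exact hv0 this
    · intro j hj
      have hjz : j = z.castSucc := by
        by_contra hne
        exact hj (hβ (Finset.mem_erase.2 ⟨hne, Finset.mem_univ _⟩))
      rw [hjz]
      simp [hxz]
    · intro i _
      rw [extB_mulVec, hker]
      simp
  refine ⟨extB B x, ?_, ?_, ?_, ?_⟩
  · unfold Matrix.IsSymm extB
    rw [Matrix.transpose_mul, Matrix.transpose_mul, Matrix.transpose_transpose, hB.eq,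
      Matrix.mul_assoc]
  · intro k hk hkn
    rcases hAS k hk hkn with h | h
    · rw [h, qprEntry_eq_A]
      exact hx k hk (by omega) ((qprEntry_eq_A _ _).1 h)
    · rw [h, qprEntry_eq_S]
      obtain ⟨h1, h2⟩ := (qprEntry_eq_S _ _).1 h
      constructor
      · intro hall
        apply h1
        intro α β hqp
        exact (qMinor_castSucc B x α β (hqp.2.1.trans hqp.1.symm)).1 (hall _ _ (isQPPair_map hqp))
      · intro hall
        apply h2
        intro α β hqp
        by_contra hne
        exact (qMinor_castSucc B x α β (hqp.2.1.trans hqp.1.symm)).2 hne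
          (hall _ _ (isQPPair_map hqp))
  · rw [qprEntry_eq_S]
    constructor
    · intro hall
      refine hall (Finset.univ.erase z.castSucc) (Finset.univ.erase z.castSucc) ?_
        (hzero _ _ rfl (Finset.Subset.refl _))
      have := isQPPair_self (Finset.univ.erase z.castSucc)
      rwa [hcz] at this
    · intro hall
      have hu : IsQPPair n (Finset.univ : Finset (Fin n)) Finset.univ := by
        have := isQPPair_self (Finset.univ : Finset (Fin n))
        rwa [Finset.card_univ, Fintype.card_fin] at this
      exact (qMinor_castSucc B x _ _ rfl).2 ((qprEntry_eq_A _ _).1 hlast _ _ hu)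
        (hall _ _ (isQPPair_map hu))
  · rw [qprEntry_eq_N]
    constructor
    · intro hall
      refine hall Finset.univ Finset.univ ?_ (hzero _ _ rfl (Finset.subset_univ _))
      have := isQPPair_self (Finset.univ : Finset (Fin (n + 1)))
      rwa [Finset.card_univ, Fintype.card_fin] at this
    · intro α β hqp
      have hβ : β = Finset.univ := by
        rw [← Finset.card_eq_iff_eq_univ, hqp.2.1]; simp
      exact hzero _ _ (hqp.2.1.trans hqp.1.symm) (by rw [hβ]; exact Finset.subset_univ _)
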